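/- For r, s > 0, the maximum over real v of the function f(v) = -2(√(r+s) - √s)·|v + √(r+s)| - v²/2 equals -(r+s)/2 if 3s ≤ r (achieved at v = -√(r+s)), and equals -2(√(r+s) - √s)·√s if 3s > r (achieved at v = -2(√(r+s) - √s)). -/

import Mathlib

theorem opt2 (r s : ℝ) (hr : 0 < r) (hs : 0 < s) :
    (3 * s ≤ r →
      IsGreatest
        (Set.range fun v : ℝ =>
          -2 * (Real.sqrt (r + s) - Real.sqrt s) * |v + Real.sqrt (r + s)| - v ^ 2 / 2)
        (-(r + s) / 2) ∧
      -2 * (Real.sqrt (r + s) - Real.sqrt s) * |(-Real.sqrt (r + s)) + Real.sqrt (r + s)|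
          - (-Real.sqrt (r + s)) ^ 2 / 2 = -(r + s) / 2) ∧
    (3 * s > r →
      IsGreatest
        (Set.range fun v : ℝ =>
          -2 * (Real.sqrt (r + s) - Real.sqrt s) * |v + Real.sqrt (r + s)| - v ^ 2 / 2)
        (-2 * (Real.sqrt (r + s) - Real.sqrt s) * Real.sqrt s) ∧
      -2 * (Real.sqrt (r + s) - Real.sqrt s) *
            |(-(2 * (Real.sqrt (r + s) - Real.sqrt s))) + Real.sqrt (r + s)|
          - (-(2 * (Real.sqrt (r + s) - Real.sqrt s))) ^ 2 / 2
        = -2 * (Real.sqrt (r + s) - Real.sqrt s) * Real.sqrt s) := by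
  have ha0 : 0 ≤ Real.sqrt (r + s) := Real.sqrt_nonneg _
  have hb0 : 0 < Real.sqrt s := Real.sqrt_pos.mpr hs
  have ha2 : Real.sqrt (r + s) ^ 2 = r + s := Real.sq_sqrt (by linarith)
  have hb2 : Real.sqrt s ^ 2 = s := Real.sq_sqrt hs.le
  have hab : Real.sqrt s ≤ Real.sqrt (r + s) := Real.sqrt_le_sqrt (by linarith)
  generalize Real.sqrt (r + s) = a at *
  generalize Real.sqrt s = b at *
  constructor
  · intro h
    have h2 : 2 * b ≤ a := by
      refine (pow_le_pow_iff_left₀ (by linarith) (by linarith) two_ne_zero).mp ?_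
      nlinarith
    have e : -2 * (a - b) * |(-a) + a| - (-a) ^ 2 / 2 = -(r + s) / 2 := by
      rw [neg_add_cancel, abs_zero, ← ha2]; ring
    refine ⟨⟨⟨-a, e⟩, ?_⟩, e⟩
    rintro _ ⟨v, rfl⟩
    have h3 : 0 ≤ (a - 2 * b) * |v + a| := mul_nonneg (by linarith) (abs_nonneg _)
    have h4 : 0 ≤ a * (|v + a| - (v + a)) :=
      mul_nonneg ha0 (sub_nonneg.mpr (le_abs_self _))
    simp only
    rw [← ha2]
    nlinarith [sq_nonneg (v + a)]
  · intro h
    have h2 : a ≤ 2 * b := by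
      refine (pow_le_pow_iff_left₀ (by linarith) (by linarith) two_ne_zero).mp ?_
      nlinarith
    have e : -2 * (a - b) * |(-(2 * (a - b))) + a| - (-(2 * (a - b))) ^ 2 / 2
        = -2 * (a - b) * b := by
      rw [abs_of_nonneg (by linarith)]; ring
    refine ⟨⟨⟨-(2 * (a - b)), e⟩, ?_⟩, e⟩
    rintro _ ⟨v, rfl⟩
    have h4 : 0 ≤ (a - b) * (|v + a| - (v + a)) :=
      mul_nonneg (by linarith) (sub_nonneg.mpr (le_abs_self _))
    simp only
    nlinarith [sq_nonneg (v + 2 * (a - b))]
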